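/- arXiv:2306.09783 — 6 statements merged into one kernel-verified Lean document; each statement's English description precedes it below -/
import Mathlib

section
/- Let w be a positive integer and let (φ_i)_{i≥0} be a family of functions from ℝ to ℝ satisfying φ_0(s) = e^s and, for every i ≥ 1 and every s ∈ ℝ, φ_i(s) = (w·e^s)/(w+i) + (e^s/(w+i))·Σ_{k=0}^{i−1} φ_k(s). Then for every i ≥ 1 and every s ∈ ℝ, φ_i(s) = e^s · ∏_{k=1}^{i} (w+k−1+e^s)/(w+k). -/
/-- MementoHash external loop MGF recursion: closed-form solution.
If `φ 0 s = e^s` and for `i ≥ 1`,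
`φ i s = (w e^s)/(w+i) + (e^s/(w+i)) ∑_{k=0}^{i-1} φ k s`,
then `φ i s = e^s ∏_{k=1}^{i} (w+k-1+e^s)/(w+k)` for all `i ≥ 1`. -/
theorem stmt_0 (w : ℕ) (hw : 0 < w) (φ : ℕ → ℝ → ℝ)
    (h0 : ∀ s : ℝ, φ 0 s = Real.exp s)
    (hrec : ∀ i : ℕ, 1 ≤ i → ∀ s : ℝ,
      φ i s = ((w : ℝ) * Real.exp s) / ((w : ℝ) + i)
        + (Real.exp s / ((w : ℝ) + i)) * ∑ k ∈ Finset.range i, φ k s) :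
    ∀ i : ℕ, 1 ≤ i → ∀ s : ℝ,
      φ i s = Real.exp s * ∏ k ∈ Finset.Icc 1 i,
        ((w : ℝ) + (k : ℝ) - 1 + Real.exp s) / ((w : ℝ) + (k : ℝ)) := by
  intro i _ s
  have hwp : (0 : ℝ) < w := by exact_mod_cast hw
  have key : ∀ i : ℕ, ((w : ℝ) + i) * φ i s
      = w * Real.exp s + Real.exp s * ∑ k ∈ Finset.range i, φ k s := by
    intro i
    rcases Nat.eq_zero_or_pos i with h | h
    · subst h
      simp [h0]
    · have hp : (w : ℝ) + i ≠ 0 := by positivity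
      rw [hrec i h s]
      field_simp
  clear * - key h0 hwp
  induction i with
  | zero => simp [h0]
  | succ n ih =>
    rw [Finset.prod_Icc_succ_top (by omega), ← mul_assoc, ← ih]
    have h1 := key n
    have h2 := key (n + 1)
    rw [Finset.sum_range_succ] at h2
    push_cast at h2 ⊢
    have hp : (w : ℝ) + (n + 1) ≠ 0 := by positivity
    rw [← mul_div_assoc, eq_div_iff hp]
    linear_combination h2 - h1
end

section
/- Let w be a positive integer, let i ≥ 0, and define φ_i : ℝ → ℝ by φ_i(s) = e^s · ∏_{k=1}^{i} (w+k−1+e^s)/(w+k). Then φ_i''(0) − (φ_i'(0))² = Σ_{k=1}^{i} (w+k−1)/(w+k)². -/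
theorem aux_mgf (w : ℕ) (hw : 0 < w) (i : ℕ) : ∃ f1 f2 : ℝ → ℝ,
    (∀ s, HasDerivAt (fun s : ℝ => Real.exp s * ∏ k ∈ Finset.Icc 1 i,
      ((w : ℝ) + (k : ℝ) - 1 + Real.exp s) / ((w : ℝ) + (k : ℝ))) (f1 s) s) ∧
    (∀ s, HasDerivAt f1 (f2 s) s) ∧
    (Real.exp 0 * ∏ k ∈ Finset.Icc 1 i,
      ((w : ℝ) + (k : ℝ) - 1 + Real.exp 0) / ((w : ℝ) + (k : ℝ)) = 1) ∧
    f2 0 - f1 0 ^ 2 = ∑ k ∈ Finset.Icc 1 i, ((w : ℝ) + (k : ℝ) - 1) / ((w : ℝ) + (k : ℝ)) ^ 2 := by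
  induction i with
  | zero =>
    refine ⟨Real.exp, Real.exp, ?_, Real.hasDerivAt_exp, by simp, by simp⟩
    intro s
    simpa using Real.hasDerivAt_exp s
  | succ n ih =>
    obtain ⟨f1, f2, h1, h2, h3, h4⟩ := ih
    simp only [Finset.prod_Icc_succ_top (Nat.le_add_left 1 n),
      Finset.sum_Icc_succ_top (Nat.le_add_left 1 n), ← mul_assoc]
    have hc : (w : ℝ) + ((n + 1 : ℕ) : ℝ) ≠ 0 := by positivity
    generalize (w : ℝ) + ((n + 1 : ℕ) : ℝ) = c at hc ⊢
    have hg : ∀ s, HasDerivAt (fun s : ℝ => (c - 1 + Real.exp s) / c) (Real.exp s / c) s :=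
      fun s => ((Real.hasDerivAt_exp s).const_add (c - 1)).div_const c
    have hg2 : ∀ s, HasDerivAt (fun s : ℝ => Real.exp s / c) (Real.exp s / c) s :=
      fun s => (Real.hasDerivAt_exp s).div_const c
    refine ⟨_, _, fun s => (h1 s).mul (hg s),
      fun s => ((h2 s).mul (hg s)).add ((h1 s).mul (hg2 s)), ?_, ?_⟩
    · rw [h3, Real.exp_zero]
      field_simp
      ring
    · rw [← h4]
      simp only [h3]
      rw [Real.exp_zero]
      field_simp
      ring

/-- The variance extracted from the closed-form MGF
`φ_i(s) = e^s ∏_{k=1}^{i} (w+k-1+e^s)/(w+k)`: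
`φ_i''(0) − (φ_i'(0))² = ∑_{k=1}^{i} (w+k-1)/(w+k)²`. -/
theorem stmt_3 (w : ℕ) (hw : 0 < w) (i : ℕ) (φ : ℝ → ℝ)
    (hφ : ∀ s : ℝ, φ s = Real.exp s * ∏ k ∈ Finset.Icc 1 i,
      ((w : ℝ) + (k : ℝ) - 1 + Real.exp s) / ((w : ℝ) + (k : ℝ))) :
    deriv (deriv φ) 0 - (deriv φ 0) ^ 2
      = ∑ k ∈ Finset.Icc 1 i, ((w : ℝ) + (k : ℝ) - 1) / ((w : ℝ) + (k : ℝ)) ^ 2 := by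
  obtain ⟨f1, f2, h1, h2, -, h4⟩ := aux_mgf w hw i
  obtain rfl := funext hφ
  rw [show deriv _ = f1 from funext fun s => (h1 s).deriv, (h2 0).deriv, h4]
end

section
/- Let w be a positive integer and let (E_i)_{i≥0} and (M_i)_{i≥0} be sequences of real numbers satisfying E_0 = 1, M_0 = 1, and for every i ≥ 1, E_i = 1 + (1/(w+i))·Σ_{k=0}^{i−1} E_k and M_i = 1 + (1/(w+i))·Σ_{k=0}^{i−1} (2·E_k + M_k). Then for every i ≥ 0, M_i − E_i² = Σ_{k=1}^{i} (w+k−1)/(w+k)². -/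
/-- First and second moment recursions of the external loop count: if `E 0 = 1`, `M 0 = 1`,
and for `i ≥ 1`, `E i = 1 + (1/(w+i)) ∑_{k<i} E k` and
`M i = 1 + (1/(w+i)) ∑_{k<i} (2 E k + M k)`, then the variance satisfies
`M i − (E i)² = ∑_{k=1}^{i} (w+k−1)/(w+k)²`. -/
theorem stmt_7 (w : ℕ) (hw : 0 < w) (E M : ℕ → ℝ)
    (hE0 : E 0 = 1) (hM0 : M 0 = 1)
    (hErec : ∀ i : ℕ, 1 ≤ i →
      E i = 1 + (1 / ((w : ℝ) + (i : ℝ))) * ∑ k ∈ Finset.range i, E k)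
    (hMrec : ∀ i : ℕ, 1 ≤ i →
      M i = 1 + (1 / ((w : ℝ) + (i : ℝ))) * ∑ k ∈ Finset.range i, (2 * E k + M k)) :
    ∀ i : ℕ, M i - (E i) ^ 2
      = ∑ k ∈ Finset.Icc 1 i, ((w : ℝ) + (k : ℝ) - 1) / ((w : ℝ) + (k : ℝ)) ^ 2 := by
  have hpos : ∀ i : ℕ, (0 : ℝ) < (w : ℝ) + (i : ℝ) := fun i => by positivity
  have hE : ∀ i : ℕ, ((w : ℝ) + i) * (E i - 1) = ∑ k ∈ Finset.range i, E k := by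
    intro i
    rcases Nat.eq_zero_or_pos i with rfl | h
    · simp [hE0]
    · have hp := (hpos i).ne'
      rw [hErec i h]
      field_simp
      ring
  have hM : ∀ i : ℕ, ((w : ℝ) + i) * (M i - 1) = ∑ k ∈ Finset.range i, (2 * E k + M k) := by
    intro i
    rcases Nat.eq_zero_or_pos i with rfl | h
    · simp [hM0]
    · have hp := (hpos i).ne'
      rw [hMrec i h]
      field_simp
      ring
  intro i
  induction i with
  | zero => simp [hE0, hM0]
  | succ i ih =>
    rw [Finset.sum_Icc_succ_top (by omega), ← ih]
    have hp := (hpos (i + 1)).ne'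
    have e1 := hE (i + 1)
    have m1 := hM (i + 1)
    rw [Finset.sum_range_succ, ← hE i] at e1
    rw [Finset.sum_range_succ, ← hM i] at m1
    push_cast at *
    have e2 : E (i + 1) = E i + 1 / ((w : ℝ) + (i + 1)) := by
      field_simp
      linarith
    have m2 : M (i + 1) = M i + (1 + 2 * E i) / ((w : ℝ) + (i + 1)) := by
      field_simp
      linarith
    rw [e2, m2]
    field_simp
    ring
end

section
/- Let w be a positive integer and define, by strong recursion on i, probability mass functions T_i on ℕ: T_i is the law of the experiment that draws j uniformly from {0, 1, ..., w+i−1}, outputs 1 if j < w, and otherwise outputs 1 + X where X is drawn from T_{j−w} (note j−w < i). Then for every i ≥ 0, the variance of T_i, i.e. Σ_{a∈ℕ} a²·T_i(a) − (Σ_{a∈ℕ} a·T_i(a))², equals Σ_{k=1}^{i} (w+k−1)/(w+k)². -/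
/-- `memT w hw i` : the law of the number of iterations of the external lookup loop of
MementoHash when the bucket first hit is the `(i+1)`-th most recently removed one:
draw `j` uniformly from `{0, …, w+i−1}`; output `1` if `j < w` (a working bucket is hit),
otherwise output `1 + X` where `X ∼ memT w hw (j − w)`. -/
noncomputable def memT (w : ℕ) (hw : 0 < w) : ℕ → PMF ℕ
  | i =>
    haveI : Nonempty (Fin (w + i)) := ⟨⟨0, by omega⟩⟩
    (PMF.uniformOfFintype (Fin (w + i))).bind fun j =>
      if h : (j : ℕ) < w then PMF.pure 1
      else
        have hlt : (j : ℕ) - w < i := by have := j.isLt; omega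
        (memT w hw ((j : ℕ) - w)).map (· + 1)
  termination_by i => i

lemma memT_shift (p : PMF ℕ) (a : ℕ) :
    ((p.map (· + 1)) a).toReal = if a = 0 then 0 else (p (a - 1)).toReal := by
  rw [PMF.map_apply]
  cases a with
  | zero => simp
  | succ b =>
    rw [tsum_eq_single b]
    · simp
    · intro c hc
      have : ¬ (b = c) := fun h => hc h.symm
      simp [this]

lemma memT_formula (w : ℕ) (hw : 0 < w) (i a : ℕ) :
    ((w : ℝ) + i) * (memT w hw i a).toReal =
      w * ((PMF.pure 1 : PMF ℕ) a).toReal +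
        ∑ j ∈ Finset.range i, (((memT w hw j).map (· + 1)) a).toReal := by
  rw [memT]
  have hpos : (0 : ℝ) < (w : ℝ) + i := by positivity
  rw [PMF.bind_apply, tsum_fintype, ENNReal.toReal_sum
    (fun j _ => ENNReal.mul_ne_top (PMF.apply_ne_top _ _) (PMF.apply_ne_top _ _))]
  simp only [PMF.uniformOfFintype_apply, ENNReal.toReal_mul, Fintype.card_fin]
  rw [← Finset.mul_sum, Fin.sum_univ_add]
  have e : (((w + i : ℕ) : ENNReal)⁻¹).toReal = ((w : ℝ) + i)⁻¹ := by
    rw [ENNReal.toReal_inv, ENNReal.toReal_natCast]; push_cast; rfl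
  rw [e, mul_inv_cancel_left₀ hpos.ne']
  congr 1
  · simp
  · rw [Finset.sum_range]
    apply Finset.sum_congr rfl
    intro j _
    simp

lemma memT_zero (w : ℕ) (hw : 0 < w) (a : ℕ) :
    (memT w hw 0 a).toReal = ((PMF.pure 1 : PMF ℕ) a).toReal := by
  have h := memT_formula w hw 0 a
  have hpos : (0 : ℝ) < w := by exact_mod_cast hw
  simp only [Nat.cast_zero, add_zero, Finset.range_zero, Finset.sum_empty] at h
  exact mul_left_cancel₀ hpos.ne' h

lemma memT_succ (w : ℕ) (hw : 0 < w) (i a : ℕ) :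
    (memT w hw (i + 1) a).toReal = (((w : ℝ) + i) * (memT w hw i a).toReal +
      (if a = 0 then 0 else (memT w hw i (a - 1)).toReal)) / ((w : ℝ) + i + 1) := by
  have h := memT_formula w hw (i + 1) a
  rw [Finset.sum_range_succ, ← add_assoc, ← memT_formula w hw i a, memT_shift] at h
  have hpos : (0 : ℝ) < (w : ℝ) + i + 1 := by positivity
  rw [eq_div_iff hpos.ne', ← h]
  push_cast
  ring

lemma memT_hasSum_shift (f : ℕ → ℝ) (g : ℕ → ℝ) (s : ℝ)
    (h : HasSum (fun a => f (a + 1) * g a) s) :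
    HasSum (fun a => f a * (if a = 0 then 0 else g (a - 1))) s := by
  rw [← hasSum_nat_add_iff' 1]
  simpa using h

lemma memT_hasSum_step (w : ℕ) (hw : 0 < w) (i : ℕ) (f : ℕ → ℝ) (s t : ℝ)
    (h : HasSum (fun a => f a * (memT w hw i a).toReal) s)
    (h' : HasSum (fun a => f (a + 1) * (memT w hw i a).toReal) t) :
    HasSum (fun a => f a * (memT w hw (i + 1) a).toReal)
      ((((w : ℝ) + i) * s + t) / ((w : ℝ) + i + 1)) := by
  have := ((h.mul_left ((w : ℝ) + i)).add (memT_hasSum_shift f _ t h')).div_const ((w : ℝ) + i + 1)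
  refine this.congr_fun ?_
  intro a
  rw [memT_succ]
  ring

lemma memT_moments (w : ℕ) (hw : 0 < w) (i : ℕ) : ∃ m s : ℝ,
    HasSum (fun a : ℕ => (1 : ℝ) * (memT w hw i a).toReal) 1 ∧
    HasSum (fun a : ℕ => (a : ℝ) * (memT w hw i a).toReal) m ∧
    HasSum (fun a : ℕ => (a : ℝ) ^ 2 * (memT w hw i a).toReal) s ∧
    s - m ^ 2 = ∑ k ∈ Finset.Icc 1 i, ((w : ℝ) + (k : ℝ) - 1) / ((w : ℝ) + (k : ℝ)) ^ 2 := by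
  induction i with
  | zero =>
    have key : ∀ f : ℕ → ℝ, HasSum (fun a => f a * (memT w hw 0 a).toReal) (f 1) := by
      intro f
      have := hasSum_single (f := fun a => f a * (memT w hw 0 a).toReal) 1 (by
        intro b hb
        simp [memT_zero, hb])
      simpa [memT_zero] using this
    refine ⟨1, 1, key (fun _ => 1), ?_, ?_, by simp⟩
    · simpa using key (fun a => (a : ℝ))
    · convert key (fun a => (a : ℝ) ^ 2) using 1
      norm_num
  | succ i ih =>
    obtain ⟨m, s, h0, h1, h2, hv⟩ := ih
    have hpos : (0 : ℝ) < (w : ℝ) + i + 1 := by positivity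
    have g0 := memT_hasSum_step w hw i (fun _ => 1) _ _ h0 h0
    have g1 := memT_hasSum_step w hw i (fun a => (a : ℝ)) m (m + 1) h1 (by
      convert h1.add h0 using 2 with a
      push_cast; ring)
    have g2 := memT_hasSum_step w hw i (fun a => (a : ℝ) ^ 2) s (s + 2 * m + 1) h2 (by
      convert (h2.add (h1.mul_left 2)).add h0 using 2 with a
      push_cast; ring)
    refine ⟨_, _, ?_, g1, g2, ?_⟩
    · convert g0 using 1
      field_simp
    · rw [Finset.sum_Icc_succ_top (by omega), ← hv]
      push_cast
      have : (w : ℝ) + (i + 1) = w + i + 1 := by ring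
      rw [this]
      field_simp
      ring

/-- The variance of `memT w hw i` equals `∑_{k=1}^{i} (w+k−1)/(w+k)²`. -/
theorem stmt_9 (w : ℕ) (hw : 0 < w) (i : ℕ) :
    (∑' a : ℕ, (a : ℝ) ^ 2 * ((memT w hw i) a).toReal)
        - (∑' a : ℕ, (a : ℝ) * ((memT w hw i) a).toReal) ^ 2
      = ∑ k ∈ Finset.Icc 1 i, ((w : ℝ) + (k : ℝ) - 1) / ((w : ℝ) + (k : ℝ)) ^ 2 := by
  obtain ⟨m, s, -, h1, h2, hv⟩ := memT_moments w hw i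
  rw [h1.tsum_eq, h2.tsum_eq, hv]
end

section
/- Let w be a positive integer and x ≥ 0 an integer. Define, by strong recursion on i ≥ x, probability mass functions S_{x,i} on ℕ: S_{x,i} is the law of the experiment that draws j uniformly from {0, 1, ..., w+i−1}, outputs 1 if j < w+x, and otherwise outputs 1 + X where X is drawn from S_{x,j−w} (note x ≤ j−w < i). Then for every i ≥ x, the expectation Σ_{a∈ℕ} a·S_{x,i}(a) is at most 1 + Σ_{k=1}^{i} 1/(w+k). -/
/-- `memS w x hw i` : the law of the number of iterations of the internal lookup loop of
MementoHash with termination threshold `x`: draw `j` uniformly from `{0, …, w+i−1}`;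
output `1` if `j < w + x` (a working bucket, or one removed after the `x`-th removal,
is hit), otherwise output `1 + X` where `X ∼ memS w x hw (j − w)`
(note `x ≤ j − w < i` in that case). -/
noncomputable def memS (w x : ℕ) (hw : 0 < w) : ℕ → PMF ℕ
  | i =>
    haveI : Nonempty (Fin (w + i)) := ⟨⟨0, by omega⟩⟩
    (PMF.uniformOfFintype (Fin (w + i))).bind fun j =>
      if h : (j : ℕ) < w + x then PMF.pure 1
      else
        have hlt : (j : ℕ) - w < i := by have := j.isLt; omega
        (memS w x hw ((j : ℕ) - w)).map (· + 1)
  termination_by i => i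

noncomputable def EE (p : PMF ℕ) : ENNReal := ∑' a : ℕ, (a : ENNReal) * p a

lemma EE_bind {α : Type*} (p : PMF α) (f : α → PMF ℕ) :
    EE (p.bind f) = ∑' j, p j * EE (f j) := by
  unfold EE
  simp_rw [PMF.bind_apply, ← ENNReal.tsum_mul_left]
  rw [ENNReal.tsum_comm]
  refine tsum_congr fun j => tsum_congr fun a => ?_
  ring

lemma EE_pure (n : ℕ) : EE (PMF.pure n) = n := by
  unfold EE
  rw [tsum_eq_single n]
  · simp
  · intro b hb
    simp [PMF.pure_apply, hb]

lemma EE_map (p : PMF ℕ) : EE (p.map (· + 1)) = EE p + 1 := by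
  rw [← PMF.bind_pure_comp, EE_bind]
  simp only [Function.comp, EE_pure, Nat.cast_add, Nat.cast_one, mul_add, mul_one]
  rw [ENNReal.tsum_add, p.tsum_coe]
  unfold EE
  simp_rw [mul_comm]

noncomputable def HH (w i : ℕ) : ℝ := ∑ k ∈ Finset.Icc 1 i, (1 : ℝ) / ((w : ℝ) + (k : ℝ))

lemma HH_nonneg (w i : ℕ) : 0 ≤ HH w i := Finset.sum_nonneg fun _ _ => by positivity

lemma HH_sum (w i : ℕ) : ∑ m ∈ Finset.range i, (1 + HH w m) = (w + i : ℝ) * HH w i := by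
  induction i with
  | zero => simp [HH]
  | succ n ih =>
    have h : HH w (n+1) = HH w n + 1 / ((w : ℝ) + ((n + 1 : ℕ) : ℝ)) := by
      unfold HH
      rw [Finset.sum_Icc_succ_top (by omega)]
    rw [Finset.sum_range_succ, ih, h]
    push_cast
    have : (w : ℝ) + (n + 1) ≠ 0 := by positivity
    field_simp
    ring

lemma EE_le (w x : ℕ) (hw : 0 < w) (i : ℕ) :
    EE (memS w x hw i) ≤ ENNReal.ofReal (1 + HH w i) := by
  induction i using Nat.strong_induction_on with
  | _ i ih =>
  rw [memS]
  have : Nonempty (Fin (w + i)) := ⟨⟨0, by omega⟩⟩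
  rw [EE_bind, tsum_fintype]
  let g : ℕ → ℝ := fun j => if j < w then 1 else 1 + (1 + HH w (j - w))
  have hg : ∀ j, 0 ≤ g j := fun j => by
    have := HH_nonneg w (j - w)
    simp only [g]; split_ifs <;> linarith
  have hwi : (0 : ℝ) < (w : ℝ) + i := by positivity
  calc _ ≤ ∑ j : Fin (w + i), ENNReal.ofReal (((w : ℝ) + i)⁻¹ * g j) := by
        refine Finset.sum_le_sum fun j _ => ?_
        rw [PMF.uniformOfFintype_apply, ENNReal.ofReal_mul (by positivity),
          ENNReal.ofReal_inv_of_pos hwi, Fintype.card_fin, ← Nat.cast_add, ENNReal.ofReal_natCast]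
        refine mul_le_mul_right ?_ _
        have hH := HH_nonneg w ((j : ℕ) - w)
        split_ifs with h
        · rw [EE_pure, Nat.cast_one, ENNReal.one_le_ofReal]
          simp only [g]; split_ifs <;> linarith
        · have h2 : ¬ ((j : ℕ) < w) := by omega
          have h3 : (j : ℕ) - w < i := by have := j.isLt; omega
          simp only [g, h2, if_false]
          rw [EE_map, add_comm, ENNReal.ofReal_add (by norm_num) (by linarith),
            ENNReal.ofReal_one]
          exact add_le_add le_rfl (ih _ h3)
    _ = ENNReal.ofReal (1 + HH w i) := by
        rw [← ENNReal.ofReal_sum_of_nonneg (fun j _ => mul_nonneg (by positivity) (hg _)),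
          ← Finset.mul_sum, Fin.sum_univ_eq_sum_range g, Finset.sum_range_add]
        have h1 : ∑ j ∈ Finset.range w, g j = w := by
          rw [Finset.sum_congr rfl (g := fun _ => (1 : ℝ))]
          · simp
          · intro j hj
            simp [g, Finset.mem_range.1 hj]
        have h2 : ∑ j ∈ Finset.range i, g (w + j) = i + (w + i) * HH w i := by
          rw [← HH_sum]
          simp [g, Finset.sum_add_distrib]
        rw [h1, h2]
        congr 1
        field_simp
        ring

/-- For every `i ≥ x`, the expectation of `memS w x hw i` is at most
`1 + ∑_{k=1}^{i} 1/(w+k)`. -/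
theorem stmt_11 (w x : ℕ) (hw : 0 < w) :
    ∀ i : ℕ, x ≤ i →
      ∑' a : ℕ, (a : ℝ) * ((memS w x hw i) a).toReal
        ≤ 1 + ∑ k ∈ Finset.Icc 1 i, (1 : ℝ) / ((w : ℝ) + (k : ℝ)) := by
  intro i _
  have h := EE_le w x hw i
  have h0 := HH_nonneg w i
  have h1 : ∑' a : ℕ, (a : ℝ) * ((memS w x hw i) a).toReal = (EE (memS w x hw i)).toReal := by
    unfold EE
    rw [ENNReal.tsum_toReal_eq]
    · simp
    · intro a
      exact ENNReal.mul_ne_top (ENNReal.natCast_ne_top a) (PMF.apply_ne_top _ _)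
  rw [h1]
  change _ ≤ 1 + HH w i
  exact ENNReal.toReal_le_of_le_ofReal (by linarith) h
end

section
/- Let w be a positive integer and x ≥ 0 an integer. Define, by strong recursion, probability mass functions T_i on ℕ for i ≥ 0 (T_i draws j uniformly from {0,...,w+i−1}, outputs 1 if j < w, else 1 + a sample of T_{j−w}) and S_{x,i} on ℕ for i ≥ x (S_{x,i} draws j uniformly from {0,...,w+i−1}, outputs 1 if j < w+x, else 1 + a sample of S_{x,j−w}). Then for every i ≥ x and every real t ≥ 0, the moment generating function satisfies Σ_{a∈ℕ} e^{t·a}·S_{x,i}(a) ≤ Σ_{a∈ℕ} e^{t·a}·T_i(a). -/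
/-- Extended-real moment generating function. -/
noncomputable def mgfE (t : ℝ) (p : PMF ℕ) : ENNReal :=
  ∑' a : ℕ, ENNReal.ofReal (Real.exp (t * (a : ℝ))) * p a

lemma mgfE_bind {α : Type} (t : ℝ) (u : PMF α) (f : α → PMF ℕ) :
    mgfE t (u.bind f) = ∑' j, u j * mgfE t (f j) := by
  unfold mgfE
  simp only [PMF.bind_apply, ← ENNReal.tsum_mul_left]
  rw [ENNReal.tsum_comm]
  refine tsum_congr fun j => tsum_congr fun a => ?_
  ring

lemma mgfE_pure (t : ℝ) (n : ℕ) :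
    mgfE t (PMF.pure n) = ENNReal.ofReal (Real.exp (t * (n : ℝ))) := by
  unfold mgfE
  rw [tsum_eq_single n]
  · simp
  · intro b hb
    simp [PMF.pure_apply, hb]

lemma mgfE_map (t : ℝ) (p : PMF ℕ) :
    mgfE t (p.map (· + 1)) = ENNReal.ofReal (Real.exp t) * mgfE t p := by
  rw [← PMF.bind_pure_comp, mgfE_bind]
  simp only [Function.comp, mgfE_pure]
  unfold mgfE
  rw [← ENNReal.tsum_mul_left]
  refine tsum_congr fun a => ?_
  rw [← mul_assoc, ← ENNReal.ofReal_mul (Real.exp_pos _).le, ← Real.exp_add, mul_comm]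
  congr 3
  push_cast
  ring

lemma one_le_mgfE (t : ℝ) (ht : 0 ≤ t) (p : PMF ℕ) : 1 ≤ mgfE t p := by
  rw [← p.tsum_coe]
  unfold mgfE
  refine ENNReal.tsum_le_tsum fun a => ?_
  refine le_mul_of_one_le_left zero_le ?_
  rw [← ENNReal.ofReal_one]
  exact ENNReal.ofReal_le_ofReal (Real.one_le_exp (by positivity))

lemma mgfE_le (w x : ℕ) (hw : 0 < w) (t : ℝ) (ht : 0 ≤ t) (i : ℕ) :
    mgfE t (memS w x hw i) ≤ mgfE t (memT w hw i) := by
  induction i using Nat.strong_induction_on with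
  | _ i ih =>
    rw [memS, memT, mgfE_bind, mgfE_bind]
    refine ENNReal.tsum_le_tsum fun j => mul_le_mul_right ?_ _
    have hj := j.isLt
    by_cases h1 : (j : ℕ) < w
    · have h2 : (j : ℕ) < w + x := by omega
      simp [h1, h2]
    · by_cases h2 : (j : ℕ) < w + x
      · simp only [h1, h2, dif_pos, dif_neg, not_false_eq_true]
        rw [mgfE_map, mgfE_pure]
        simpa using le_mul_of_one_le_right (zero_le (a := ENNReal.ofReal (Real.exp t)))
          (one_le_mgfE t ht _)
      · simp only [h1, h2, dif_neg, not_false_eq_true]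
        rw [mgfE_map, mgfE_map]
        exact mul_le_mul_right (ih _ (by omega)) _

lemma mgfE_memT_ne_top (w : ℕ) (hw : 0 < w) (t : ℝ) (i : ℕ) :
    mgfE t (memT w hw i) ≠ ⊤ := by
  induction i using Nat.strong_induction_on with
  | _ i ih =>
    rw [memT, mgfE_bind, tsum_fintype]
    refine ENNReal.sum_ne_top.2 fun j _ => ENNReal.mul_ne_top (PMF.apply_ne_top _ _) ?_
    have hj := j.isLt
    by_cases h1 : (j : ℕ) < w
    · simp only [h1, dif_pos]
      rw [mgfE_pure]
      exact ENNReal.ofReal_ne_top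
    · simp only [h1, dif_neg, not_false_eq_true]
      rw [mgfE_map]
      exact ENNReal.mul_ne_top ENNReal.ofReal_ne_top (ih _ (by omega))

lemma mgfE_toReal (t : ℝ) (p : PMF ℕ) :
    ∑' a : ℕ, Real.exp (t * (a : ℝ)) * (p a).toReal = (mgfE t p).toReal := by
  unfold mgfE
  rw [ENNReal.tsum_toReal_eq
    (fun a => ENNReal.mul_ne_top ENNReal.ofReal_ne_top (PMF.apply_ne_top _ _))]
  refine tsum_congr fun a => ?_
  rw [ENNReal.toReal_mul, ENNReal.toReal_ofReal (Real.exp_pos _).le]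

/-- MGF domination: for every `i ≥ x` and every `t ≥ 0`, the moment generating function
of the internal-loop count `memS w x hw i` is at most that of the threshold-0 process
`memT w hw i`. -/
theorem stmt_12 (w x : ℕ) (hw : 0 < w) :
    ∀ i : ℕ, x ≤ i → ∀ t : ℝ, 0 ≤ t →
      ∑' a : ℕ, Real.exp (t * (a : ℝ)) * ((memS w x hw i) a).toReal
        ≤ ∑' a : ℕ, Real.exp (t * (a : ℝ)) * ((memT w hw i) a).toReal := by
  intro i _ t ht
  rw [mgfE_toReal, mgfE_toReal]
  exact ENNReal.toReal_mono (mgfE_memT_ne_top w hw t i) (mgfE_le w x hw t ht i)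
end
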